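/- (Interior tangency rigidity for prescribed mean curvature graphs) Let B ⊆ ℝⁿ be a connected open set, H : B × ℝ → ℝ be C¹, and u, ū ∈ C²(B) satisfy div(∇u/√(1+|∇u|²)) = nH(x,u) and div(∇ū/√(1+|∇ū|²)) = nH(x,ū) on B. If u ≤ ū on B and u(x₀) = ū(x₀) for some x₀ ∈ B, then u ≡ ū on B. -/

import Mathlib

/-- Partial derivative `∂f/∂x_i` at `x`. -/
noncomputable def pd {n : ℕ} (f : EuclideanSpace ℝ (Fin n) → ℝ) (i : Fin n)
    (x : EuclideanSpace ℝ (Fin n)) : ℝ :=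
  fderiv ℝ f x (EuclideanSpace.single i 1)

/-- The nonparametric mean curvature operator `div(∇v/√(1+|∇v|²))`. -/
noncomputable def MCdiv {n : ℕ} (v : EuclideanSpace ℝ (Fin n) → ℝ)
    (x : EuclideanSpace ℝ (Fin n)) : ℝ :=
  ∑ i, pd (fun y => gradient v y i / Real.sqrt (1 + ‖gradient v y‖ ^ 2)) i x

open scoped RealInnerProductSpace

/-- The quasilinear operator in nondivergence form. -/
noncomputable def QQ {n : ℕ} (p : EuclideanSpace ℝ (Fin n))
    (X : EuclideanSpace ℝ (Fin n) →L[ℝ] EuclideanSpace ℝ (Fin n) →L[ℝ] ℝ) : ℝ :=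
  (Real.sqrt (1 + ‖p‖ ^ 2))⁻¹ * (∑ i, X (EuclideanSpace.single i 1) (EuclideanSpace.single i 1))
    - (Real.sqrt (1 + ‖p‖ ^ 2))⁻¹ ^ 3 * X p p

lemma QQ_sub {n : ℕ} (p : EuclideanSpace ℝ (Fin n)) (X Y) : QQ p (X - Y) = QQ p X - QQ p Y := by
  simp [QQ, Finset.sum_sub_distrib]; ring

lemma QQ_add {n : ℕ} (p : EuclideanSpace ℝ (Fin n)) (X Y) : QQ p (X + Y) = QQ p X + QQ p Y := by
  simp [QQ, Finset.sum_add_distrib]; ring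

lemma QQ_smul {n : ℕ} (p : EuclideanSpace ℝ (Fin n)) (c : ℝ) (X) : QQ p (c • X) = c * QQ p X := by
  simp [QQ, ← Finset.mul_sum]; ring

lemma QQ_contDiff {n : ℕ} : ContDiff ℝ 1 (fun z : EuclideanSpace ℝ (Fin n) ×
    (EuclideanSpace ℝ (Fin n) →L[ℝ] EuclideanSpace ℝ (Fin n) →L[ℝ] ℝ) => QQ z.1 z.2) := by
  have hs : ContDiff ℝ 1 (fun z : EuclideanSpace ℝ (Fin n) ×
    (EuclideanSpace ℝ (Fin n) →L[ℝ] EuclideanSpace ℝ (Fin n) →L[ℝ] ℝ) =>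
      (Real.sqrt (1 + ‖z.1‖ ^ 2))⁻¹) := by
    refine ContDiff.inv (ContDiff.sqrt ?_ ?_) ?_
    · exact contDiff_const.add (contDiff_fst.norm_sq ℝ)
    · intro x; positivity
    · intro x; positivity
  unfold QQ
  refine (hs.mul (ContDiff.sum fun i _ => ?_)).sub ((hs.pow 3).mul ?_)
  · exact (contDiff_snd.clm_apply contDiff_const).clm_apply contDiff_const
  · exact (contDiff_snd.clm_apply contDiff_fst).clm_apply contDiff_fst

lemma vec_sum {n : ℕ} (p : EuclideanSpace ℝ (Fin n)) :
    p = ∑ i, p i • EuclideanSpace.single i (1:ℝ) := by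
  ext j
  simp [Finset.sum_apply, Pi.single_apply]

lemma bil_sum {n : ℕ} (p : EuclideanSpace ℝ (Fin n))
    (X : EuclideanSpace ℝ (Fin n) →L[ℝ] EuclideanSpace ℝ (Fin n) →L[ℝ] ℝ) :
    X p p = ∑ i, ∑ j, p i * p j * X (EuclideanSpace.single i 1) (EuclideanSpace.single j 1) := by
  conv_lhs => rw [vec_sum p]
  simp only [map_sum, map_smul, sum_apply, smul_apply,
    smul_eq_mul, Finset.mul_sum]
  rw [Finset.sum_comm]
  refine Finset.sum_congr rfl fun i _ => Finset.sum_congr rfl fun j _ => ?_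
  ring

lemma trace_ge {n : ℕ} (p : EuclideanSpace ℝ (Fin n))
    (X : EuclideanSpace ℝ (Fin n) →L[ℝ] EuclideanSpace ℝ (Fin n) →L[ℝ] ℝ)
    (hX : ∀ h, X h h ≤ 0) :
    ‖p‖ ^ 2 * (∑ i, X (EuclideanSpace.single i 1) (EuclideanSpace.single i 1)) ≤ X p p := by
  set e : Fin n → EuclideanSpace ℝ (Fin n) := fun i => EuclideanSpace.single i 1 with he
  have h1 : ∑ i, ∑ j, X (p i • e j - p j • e i) (p i • e j - p j • e i) ≤ 0 :=
    Finset.sum_nonpos fun i _ => Finset.sum_nonpos fun j _ => hX _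
  have h2 : ∑ i, ∑ j, X (p i • e j - p j • e i) (p i • e j - p j • e i)
      = ∑ i, ∑ j, (p i ^ 2 * X (e j) (e j)) + ∑ i, ∑ j, (p j ^ 2 * X (e i) (e i))
        - ∑ i, ∑ j, (p i * p j * X (e i) (e j)) - ∑ i, ∑ j, (p j * p i * X (e j) (e i)) := by
    simp only [← Finset.sum_add_distrib, ← Finset.sum_sub_distrib]
    refine Finset.sum_congr rfl fun i _ => Finset.sum_congr rfl fun j _ => ?_
    simp; ring
  have h3 : ∑ i, ∑ j, (p j * p i * X (e j) (e i)) = X p p := by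
    rw [bil_sum, Finset.sum_comm]
  have h4 : ∑ i, ∑ j, (p j ^ 2 * X (e i) (e i)) = ∑ i, ∑ j, (p i ^ 2 * X (e j) (e j)) :=
    Finset.sum_comm
  have h5 : ∑ i, ∑ j, (p i ^ 2 * X (e j) (e j)) = ‖p‖ ^ 2 * ∑ i, X (e i) (e i) := by
    rw [EuclideanSpace.norm_sq_eq, Finset.sum_mul]
    simp [Finset.mul_sum]
  rw [h2, h3, h4, h5, ← bil_sum] at h1
  linarith

lemma QQ_nonpos {n : ℕ} (p : EuclideanSpace ℝ (Fin n))
    (X : EuclideanSpace ℝ (Fin n) →L[ℝ] EuclideanSpace ℝ (Fin n) →L[ℝ] ℝ)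
    (hX : ∀ h, X h h ≤ 0) : QQ p X ≤ 0 := by
  have h := trace_ge p X hX
  have ht : (∑ i, X (EuclideanSpace.single i 1) (EuclideanSpace.single i 1)) ≤ 0 :=
    Finset.sum_nonpos fun i _ => hX _
  unfold QQ
  set t := (∑ i, X (EuclideanSpace.single i 1) (EuclideanSpace.single i 1))
  have hs : 0 < 1 + ‖p‖ ^ 2 := by positivity
  have hs2 := Real.sq_sqrt hs.le
  have hs0 := Real.sqrt_pos.2 hs
  set s := Real.sqrt (1 + ‖p‖ ^ 2)
  have : s⁻¹ * t - s⁻¹ ^ 3 * X p p = s⁻¹ ^ 3 * (s ^ 2 * t - X p p) := by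
    field_simp
  rw [this, hs2]
  apply mul_nonpos_of_nonneg_of_nonpos (by positivity)
  linarith

lemma MCdiv_eq {n : ℕ} (u : EuclideanSpace ℝ (Fin n) → ℝ) (x : EuclideanSpace ℝ (Fin n))
    (hu : ContDiffAt ℝ 2 u x) : MCdiv u x = QQ (gradient u x) (fderiv ℝ (fderiv ℝ u) x) := by
  set X := fderiv ℝ (fderiv ℝ u) x with hXdef
  have hX : HasFDerivAt (fderiv ℝ u) X x :=
    ((hu.fderiv_right (m := 1) (by norm_num)).differentiableAt (by norm_num)).hasFDerivAt
  set J := (InnerProductSpace.toDual ℝ (EuclideanSpace ℝ (Fin n))).symm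
  let J' : (EuclideanSpace ℝ (Fin n) →L[ℝ] ℝ) →L[ℝ] EuclideanSpace ℝ (Fin n) :=
    { toFun := J
      map_add' := fun a b => map_add J a b
      map_smul' := fun c a => by simp
      cont := J.continuous }
  have hG : HasFDerivAt (gradient u) (J' ∘L X) x := J'.hasFDerivAt.comp x hX
  have hJ : ∀ ℓ k, ⟪J' ℓ, k⟫ = ℓ k := fun ℓ k => InnerProductSpace.toDual_symm_apply
  set p := gradient u x with hp
  have hs : 0 < 1 + ‖p‖ ^ 2 := by positivity
  have hs2 := Real.sq_sqrt hs.le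
  have hs0 := Real.sqrt_pos.2 hs
  have key : ∀ i, pd (fun y => gradient u y i / Real.sqrt (1 + ‖gradient u y‖ ^ 2)) i x =
      (Real.sqrt (1 + ‖p‖ ^ 2))⁻¹ * X (EuclideanSpace.single i 1) (EuclideanSpace.single i 1)
      - (Real.sqrt (1 + ‖p‖ ^ 2))⁻¹ ^ 3 * (p i * X (EuclideanSpace.single i 1) p) := by
    intro i
    have h1 : HasFDerivAt (fun y => gradient u y i)
        ((EuclideanSpace.proj i : EuclideanSpace ℝ (Fin n) →L[ℝ] ℝ) ∘L (J' ∘L X)) x :=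
      (EuclideanSpace.proj i : EuclideanSpace ℝ (Fin n) →L[ℝ] ℝ).hasFDerivAt.comp x hG
    have h2 := ((hG.norm_sq).const_add 1).sqrt hs.ne'
    have h3 := h1.mul ((hasDerivAt_inv hs0.ne').comp_hasFDerivAt x h2)
    have h4 : ((J' (X (EuclideanSpace.single i 1))) i) =
        X (EuclideanSpace.single i 1) (EuclideanSpace.single i 1) := by
      rw [← hJ, real_inner_comm, EuclideanSpace.inner_single_left]; simp
    have h5 : ⟪p, J' (X (EuclideanSpace.single i 1))⟫ = X (EuclideanSpace.single i 1) p := by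
      rw [real_inner_comm, hJ]
    unfold pd
    simp only [div_eq_mul_inv]
    have h6 : HasFDerivAt (fun y => gradient u y i * (Real.sqrt (1 + ‖gradient u y‖ ^ 2))⁻¹) _ x := h3
    rw [h6.fderiv]
    simp [h4, h5, ← hp]
    field_simp
    try ring
  unfold MCdiv QQ
  rw [Finset.sum_congr rfl fun i _ => key i, Finset.sum_sub_distrib, ← Finset.mul_sum,
    ← Finset.mul_sum]
  congr 2
  have hXp : X p = ∑ i, p i • X (EuclideanSpace.single i 1) := by
    conv_lhs => rw [vec_sum p]
    simp only [map_sum, map_smul]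
  rw [hXp]
  simp only [sum_apply, smul_apply, smul_eq_mul]

lemma second_deriv_nonpos {E : Type*} [NormedAddCommGroup E] [NormedSpace ℝ E] (φ : E → ℝ) (q : E)
    (hφ : ContDiffAt ℝ 2 φ q) (hmax : IsLocalMax φ q) (h : E) :
    fderiv ℝ (fderiv ℝ φ) q h h ≤ 0 := by
  by_contra hcon
  push Not at hcon
  have hline : ∀ t : ℝ, HasDerivAt (fun t : ℝ => q + t • h) h t := fun t => by
    simpa using ((hasDerivAt_id t).smul_const h).const_add q
  have hcont : Filter.Tendsto (fun t : ℝ => q + t • h) (nhds 0) (nhds q) := by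
    have := (hline 0).continuousAt.tendsto
    simpa using this
  set g : ℝ → ℝ := fun t => φ (q + t • h) with hg
  have hd : ∀ᶠ x in nhds q, DifferentiableAt ℝ φ x := by
    filter_upwards [hφ.eventually (by simp)] with x hx
    exact hx.differentiableAt (by norm_num)
  have hd1 : deriv g =ᶠ[nhds 0] fun t => fderiv ℝ φ (q + t • h) h := by
    filter_upwards [hcont.eventually hd] with t ht
    exact (ht.hasFDerivAt.comp_hasDerivAt t (hline t)).deriv
  have hX : HasFDerivAt (fderiv ℝ φ) (fderiv ℝ (fderiv ℝ φ) q) q :=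
    ((hφ.fderiv_right (m := 1) (by norm_num)).differentiableAt (by norm_num)).hasFDerivAt
  have hd2 : HasDerivAt (deriv g) (fderiv ℝ (fderiv ℝ φ) q h h) 0 := by
    refine HasDerivAt.congr_of_eventuallyEq ?_ hd1
    have hX' : HasFDerivAt (fderiv ℝ φ) (fderiv ℝ (fderiv ℝ φ) q) (q + (0:ℝ) • h) := by
      simpa using hX
    exact ((ContinuousLinearMap.apply ℝ ℝ h).hasFDerivAt (x := fderiv ℝ φ (q + (0:ℝ) • h))).comp_hasDerivAt (0:ℝ)
      (hX'.comp_hasDerivAt 0 (hline 0))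
  have hg0 : deriv g 0 = 0 := by
    rw [hd1.eq_of_nhds]; simp [hmax.fderiv_eq_zero]
  have hgc : ContinuousAt g 0 := by
    have : ContinuousAt φ (q + (0:ℝ) • h) := by simpa using hφ.continuousAt
    exact ContinuousAt.comp (f := fun t : ℝ => q + t • h) this (hline 0).continuousAt
  have hmin : IsLocalMin g 0 := isLocalMin_of_deriv_deriv_pos (by rw [hd2.deriv]; exact hcon) hg0 hgc
  have hmaxg : ∀ᶠ t in nhds (0:ℝ), g t ≤ g 0 := by
    filter_upwards [hcont.eventually hmax] with t ht
    simpa [hg] using ht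
  have heq : g =ᶠ[nhds 0] fun _ => g 0 := by
    filter_upwards [hmin, hmaxg] with t h1 h2
    exact le_antisymm h2 h1
  have h3 : deriv (deriv g) 0 = 0 := by
    have := heq.deriv.deriv_eq
    rw [this]; simp
  rw [hd2.deriv] at h3
  linarith

noncomputable def bar {n : ℕ} (α : ℝ) (y x : EuclideanSpace ℝ (Fin n)) : ℝ :=
  Real.exp (-α * ‖x - y‖ ^ 2)

lemma bar_contDiff {n : ℕ} (α : ℝ) (y : EuclideanSpace ℝ (Fin n)) : ContDiff ℝ 2 (bar α y) := by
  unfold bar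
  exact (contDiff_const.mul ((contDiff_id.sub contDiff_const).norm_sq ℝ)).exp

lemma bar_hasFDerivAt {n : ℕ} (α : ℝ) (y x : EuclideanSpace ℝ (Fin n)) :
    HasFDerivAt (bar α y) ((-2 * α * bar α y x) • innerSL ℝ (x - y)) x := by
  have h1 : HasFDerivAt (fun x : EuclideanSpace ℝ (Fin n) => x - y)
      (ContinuousLinearMap.id ℝ _) x := (hasFDerivAt_id x).sub_const y
  have h2 := (h1.norm_sq.const_mul (-α)).exp
  refine h2.congr_fderiv ?_
  ext k
  simp [bar]
  ring

lemma bar_fderiv {n : ℕ} (α : ℝ) (y : EuclideanSpace ℝ (Fin n)) :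
    fderiv ℝ (bar α y) = fun x => (-2 * α * bar α y x) • innerSL ℝ (x - y) :=
  funext fun x => (bar_hasFDerivAt α y x).fderiv

lemma bar_second {n : ℕ} (α : ℝ) (y x h k : EuclideanSpace ℝ (Fin n)) :
    fderiv ℝ (fderiv ℝ (bar α y)) x h k =
      bar α y x * (4 * α ^ 2 * ⟪x - y, h⟫ * ⟪x - y, k⟫ - 2 * α * ⟪h, k⟫) := by
  have h1 : HasFDerivAt (fun x : EuclideanSpace ℝ (Fin n) => innerSL ℝ (x - y))
      (innerSL ℝ : EuclideanSpace ℝ (Fin n) →L[ℝ] _) x := by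
    have h0 : HasFDerivAt (fun x : EuclideanSpace ℝ (Fin n) => x - y)
      (ContinuousLinearMap.id ℝ _) x := (hasFDerivAt_id x).sub_const y
    exact (innerSL ℝ : EuclideanSpace ℝ (Fin n) →L[ℝ] _).hasFDerivAt.comp x h0
  have h2 := ((bar_hasFDerivAt α y x).const_mul (-2 * α)).smul h1
  rw [bar_fderiv]
  have h3 : HasFDerivAt (fun x => (-2 * α * bar α y x) • innerSL ℝ (x - y)) _ x := h2
  rw [h3.fderiv]
  change (-2 * α * bar α y x) * ⟪h, k⟫
    + ((-2 * α) * ((-2 * α * bar α y x) * ⟪x - y, h⟫)) * ⟪x - y, k⟫ = _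
  ring

lemma QQ_bar {n : ℕ} (α : ℝ) (hα : 0 ≤ α) (y x p : EuclideanSpace ℝ (Fin n)) (S : ℝ)
    (hS : Real.sqrt (1 + ‖p‖ ^ 2) ≤ S) :
    bar α y x * (4 * α ^ 2 * ‖x - y‖ ^ 2 * S⁻¹ ^ 3 - 2 * α * n) ≤
      QQ p (fderiv ℝ (fderiv ℝ (bar α y)) x) := by
  unfold QQ
  simp only [bar_second]
  have he : 0 < bar α y x := Real.exp_pos _
  set e := bar α y x
  set d := x - y
  have hsum : ∑ i, e * (4 * α ^ 2 * ⟪d, EuclideanSpace.single i (1:ℝ)⟫ *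
      ⟪d, EuclideanSpace.single i (1:ℝ)⟫ - 2 * α * ⟪EuclideanSpace.single i (1:ℝ), EuclideanSpace.single i (1:ℝ)⟫)
      = e * (4 * α ^ 2 * ‖d‖ ^ 2 - 2 * α * n) := by
    rw [EuclideanSpace.norm_sq_eq, ← Finset.mul_sum, Finset.sum_sub_distrib, Finset.mul_sum]
    congr 2
    · refine Finset.sum_congr rfl fun i _ => ?_
      rw [EuclideanSpace.inner_single_right]; simp; ring
    · simp; ring
  rw [hsum, real_inner_self_eq_norm_sq]
  have hCS : ⟪d, p⟫ * ⟪d, p⟫ ≤ ‖d‖ ^ 2 * ‖p‖ ^ 2 := by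
    have := real_inner_mul_inner_self_le d p
    simp only [real_inner_self_eq_norm_sq] at this
    exact this
  have hs : 0 < 1 + ‖p‖ ^ 2 := by positivity
  have hs2 := Real.sq_sqrt hs.le
  have hs0 := Real.sqrt_pos.2 hs
  have hs1 : 1 ≤ Real.sqrt (1 + ‖p‖ ^ 2) := by
    rw [Real.one_le_sqrt]; nlinarith [sq_nonneg ‖p‖]
  set s := Real.sqrt (1 + ‖p‖ ^ 2)
  have hinv : S⁻¹ ≤ s⁻¹ := inv_anti₀ hs0 hS
  have hSi : 0 ≤ S⁻¹ := inv_nonneg.2 (hs0.le.trans hS)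
  have hinv3 : S⁻¹ ^ 3 ≤ s⁻¹ ^ 3 := pow_le_pow_left₀ hSi hinv 3
  have hi1 : s⁻¹ ≤ 1 := inv_le_one_of_one_le₀ hs1
  have e1 : s⁻¹ = s⁻¹ ^ 3 * (1 + ‖p‖ ^ 2) := by rw [← hs2]; field_simp
  have hk : s⁻¹ * (e * (4 * α ^ 2 * ‖d‖ ^ 2 - 2 * α * n)) -
      s⁻¹ ^ 3 * (e * (4 * α ^ 2 * ⟪d, p⟫ * ⟪d, p⟫ - 2 * α * ‖p‖ ^ 2)) =
      e * (s⁻¹ ^ 3 * (4 * α ^ 2 * (‖d‖ ^ 2 + (‖d‖ ^ 2 * ‖p‖ ^ 2 - ⟪d, p⟫ * ⟪d, p⟫)))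
        + s⁻¹ ^ 3 * (2 * α * ‖p‖ ^ 2) - s⁻¹ * (2 * α * n)) := by
    have : s⁻¹ * (4 * α ^ 2 * ‖d‖ ^ 2) = s⁻¹ ^ 3 * (1 + ‖p‖ ^ 2) * (4 * α ^ 2 * ‖d‖ ^ 2) := by
      rw [← e1]
    linear_combination e * this
  rw [hk]
  apply mul_le_mul_of_nonneg_left _ he.le
  have a1 : S⁻¹ ^ 3 * (4 * α ^ 2 * ‖d‖ ^ 2) ≤ s⁻¹ ^ 3 *
      (4 * α ^ 2 * (‖d‖ ^ 2 + (‖d‖ ^ 2 * ‖p‖ ^ 2 - ⟪d, p⟫ * ⟪d, p⟫))) := by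
    apply mul_le_mul hinv3 _ (by positivity) (by positivity)
    apply mul_le_mul_of_nonneg_left _ (by positivity)
    linarith
  have a2 : 0 ≤ s⁻¹ ^ 3 * (2 * α * ‖p‖ ^ 2) := by positivity
  have a3 : s⁻¹ * (2 * α * n) ≤ 1 * (2 * α * n) := by
    apply mul_le_mul_of_nonneg_right hi1; positivity
  linarith

lemma alpha_exists (a b c : ℝ) (ha : 0 < a) : ∃ α : ℝ, 0 < α ∧ b * α + c < α ^ 2 * a := by
  refine ⟨(|b| + |c|) / a + 1, by positivity, ?_⟩
  set α := (|b| + |c|) / a + 1 with hα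
  have h1 : α * a = |b| + |c| + a := by rw [hα]; field_simp
  have h2 : 1 ≤ α := by rw [hα]; have : 0 ≤ (|b| + |c|) / a := by positivity
                        linarith
  have h3 : α ^ 2 * a = α * |b| + α * |c| + α * a := by
    linear_combination α * h1
  have h4 : b * α ≤ α * |b| := by nlinarith [le_abs_self b]
  have h5 : c ≤ α * |c| := by nlinarith [le_abs_self c, abs_nonneg c]
  nlinarith

lemma gradient_norm {n : ℕ} (u v : EuclideanSpace ℝ (Fin n) → ℝ) (x : EuclideanSpace ℝ (Fin n)) :
    ‖gradient u x - gradient v x‖ = ‖fderiv ℝ u x - fderiv ℝ v x‖ := by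
  unfold gradient
  rw [← map_sub, LinearIsometryEquiv.norm_map]

lemma lip_gen {E F : Type*} [NormedAddCommGroup E] [NormedSpace ℝ E] [FiniteDimensional ℝ E]
    [NormedAddCommGroup F] [NormedSpace ℝ F] [FiniteDimensional ℝ F] (f : E × F → ℝ)
    (hf : ContDiff ℝ 1 f) (M M3 : ℝ) : ∃ L : NNReal, ∀ p p' X, ‖p‖ ≤ M → ‖p'‖ ≤ M → ‖X‖ ≤ M3 →
      f (p, X) - f (p', X) ≤ L * ‖p - p'‖ := by
  have : ProperSpace E := FiniteDimensional.proper_real E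
  have : ProperSpace F := FiniteDimensional.proper_real F
  obtain ⟨L, hL⟩ := (hf.contDiffOn (s := Metric.closedBall 0 M ×ˢ Metric.closedBall 0 M3)
    ).exists_lipschitzOnWith one_ne_zero
      ((convex_closedBall _ _).prod (convex_closedBall _ _))
      ((isCompact_closedBall _ _).prod (isCompact_closedBall _ _))
  refine ⟨L, fun p p' X h1 h2 h3 => ?_⟩
  have h4 := hL.dist_le_mul (p, X) (Set.mk_mem_prod (by simpa using h1) (by simpa using h3))
    (p', X) (Set.mk_mem_prod (by simpa using h2) (by simpa using h3))
  rw [Prod.dist_eq] at h4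
  simp only [dist_self, dist_eq_norm, norm_nonneg, sup_of_le_left] at h4
  exact (le_abs_self _).trans h4

set_option maxHeartbeats 1600000 in
/-- The core barrier argument. -/
lemma barrier_core {n : ℕ} {B : Set (EuclideanSpace ℝ (Fin n))} (hB : IsOpen B)
    {H : EuclideanSpace ℝ (Fin n) → ℝ → ℝ}
    (hH : ContDiffOn ℝ 1 (Function.uncurry H) (B ×ˢ (Set.univ : Set ℝ)))
    {u ubar : EuclideanSpace ℝ (Fin n) → ℝ}
    (hu : ContDiffOn ℝ 2 u B) (hubar : ContDiffOn ℝ 2 ubar B)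
    (hequ : ∀ x ∈ B, MCdiv u x = n * H x (u x))
    (hequbar : ∀ x ∈ B, MCdiv ubar x = n * H x (ubar x))
    (hle : ∀ x ∈ B, u x ≤ ubar x)
    (z y : EuclideanSpace ℝ (Fin n)) (r : ℝ) (hr : 0 < r) (hzy : ‖z - y‖ = r)
    (hball : Metric.closedBall z (r / 2) ⊆ B) (hz : u z = ubar z)
    (hlt : ∀ x ∈ B, ‖x - y‖ ≤ r → x ≠ z → u x < ubar x) : False := by
  have hK : IsCompact (Metric.closedBall z (r / 2)) := isCompact_closedBall _ _
  set K := Metric.closedBall z (r / 2) with hKdef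
  have hCu : ∀ x ∈ B, ContDiffAt ℝ 2 u x := fun x hx => hu.contDiffAt (hB.mem_nhds hx)
  have hCub : ∀ x ∈ B, ContDiffAt ℝ 2 ubar x := fun x hx => hubar.contDiffAt (hB.mem_nhds hx)
  have hgradc : ∀ f : EuclideanSpace ℝ (Fin n) → ℝ, (∀ x ∈ B, ContDiffAt ℝ 2 f x) →
      ContinuousOn (gradient f) K := fun f hf x hx =>
    ((InnerProductSpace.toDual ℝ (EuclideanSpace ℝ (Fin n))).symm.continuous.continuousAt.comp
      ((hf x (hball hx)).fderiv_right (m := 1) (by norm_num)).continuousAt).continuousWithinAt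
  have hXc : ContinuousOn (fderiv ℝ (fderiv ℝ ubar)) K := fun x hx =>
    ((((hCub x (hball hx)).fderiv_right (m := 1) (by norm_num)).fderiv_right (m := 0)
      (by norm_num)).continuousAt).continuousWithinAt
  -- uniform bounds
  obtain ⟨M1, hM1⟩ := hK.exists_bound_of_continuousOn (hgradc u hCu)
  obtain ⟨M2, hM2⟩ := hK.exists_bound_of_continuousOn (hgradc ubar hCub)
  obtain ⟨M3, hM3⟩ := hK.exists_bound_of_continuousOn
    (E := EuclideanSpace ℝ (Fin n) →L[ℝ] EuclideanSpace ℝ (Fin n) →L[ℝ] ℝ) hXc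
  obtain ⟨N1, hN1⟩ := hK.exists_bound_of_continuousOn (hu.continuousOn.mono hball)
  obtain ⟨N2, hN2⟩ := hK.exists_bound_of_continuousOn (hubar.continuousOn.mono hball)
  obtain ⟨LQ, hLQ⟩ := lip_gen _ (QQ_contDiff (n := n)) (max M1 M2) M3
  obtain ⟨LH, hLH⟩ : ∃ L, LipschitzOnWith L (Function.uncurry H)
      (K ×ˢ Metric.closedBall 0 (max N1 N2)) :=
    (hH.mono (Set.prod_mono hball (Set.subset_univ _))).exists_lipschitzOnWith one_ne_zero
      ((convex_closedBall _ _).prod (convex_closedBall _ _))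
      (hK.prod (isCompact_closedBall _ _))
  set S := Real.sqrt (1 + M1 ^ 2) with hSdef
  have hS0 : 0 < S := Real.sqrt_pos.2 (by positivity)
  have hS : ∀ x ∈ K, Real.sqrt (1 + ‖gradient u x‖ ^ 2) ≤ S := fun x hx =>
    Real.sqrt_le_sqrt (by have := hM1 x hx; gcongr)
  obtain ⟨α, hα, hαbig⟩ := alpha_exists (r ^ 2 * S⁻¹ ^ 3) (2 * n + 4 * r * LQ) (n * LH)
    (by positivity)
  set c := Real.exp (-α * r ^ 2) with hc
  have hcpos : 0 < c := Real.exp_pos _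
  have hbar1 : ∀ x, bar α y x ≤ 1 := fun x => by
    unfold bar
    rw [Real.exp_le_one_iff]
    have : 0 ≤ α * ‖x - y‖ ^ 2 := by positivity
    linarith
  -- choice of ε
  obtain ⟨ε, hε, hεs⟩ : ∃ ε > 0, ∀ x ∈ Metric.sphere z (r / 2), ‖x - y‖ ≤ r →
      u x - ubar x + ε * (bar α y x - c) < 0 := by
    have hsub : Metric.sphere z (r / 2) ∩ Metric.closedBall y r ⊆ B := fun x hx =>
      hball (Metric.sphere_subset_closedBall hx.1)
    have hcomp : IsCompact (Metric.sphere z (r / 2) ∩ Metric.closedBall y r) :=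
      (isCompact_sphere _ _).inter_right Metric.isClosed_closedBall
    have hlt' : ∀ x ∈ Metric.sphere z (r / 2) ∩ Metric.closedBall y r, 0 < ubar x - u x := by
      intro x hx
      have h1 : ‖x - y‖ ≤ r := by simpa [dist_eq_norm] using hx.2
      have := hlt x (hsub hx) h1 (by
        rintro rfl
        have := hx.1
        simp at this
        linarith)
      linarith
    obtain ⟨δ, hδ, hδ'⟩ : ∃ δ > 0, ∀ x ∈ Metric.sphere z (r / 2) ∩ Metric.closedBall y r,
        δ ≤ ubar x - u x := by
      rcases (Metric.sphere z (r / 2) ∩ Metric.closedBall y r).eq_empty_or_nonempty with he | hne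
      · exact ⟨1, one_pos, by simp [he]⟩
      · obtain ⟨m, hm, hmin⟩ := hcomp.exists_isMinOn hne
          ((hubar.continuousOn.mono hsub).sub (hu.continuousOn.mono hsub))
        exact ⟨_, hlt' m hm, fun x hx => hmin hx⟩
    refine ⟨δ / 2, by positivity, fun x hx hxr => ?_⟩
    have h1 := hδ' x ⟨hx, by simpa [dist_eq_norm] using hxr⟩
    have h2 : bar α y x - c ≤ 1 := by linarith [hbar1 x]
    nlinarith
  set φ : EuclideanSpace ℝ (Fin n) → ℝ := fun x => (u x - ubar x) + ε * (bar α y x - c) with hφ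
  have hφC : ∀ x ∈ B, ContDiffAt ℝ 2 φ x := fun x hx =>
    ((hCu x hx).sub (hCub x hx)).add
      (contDiffAt_const.mul ((bar_contDiff α y).contDiffAt.sub contDiffAt_const))
  have hφc : ContinuousOn φ K := fun x hx => (hφC x (hball hx)).continuousAt.continuousWithinAt
  have hzK : z ∈ K := Metric.mem_closedBall_self (by positivity)
  obtain ⟨q, hqK, hqmax⟩ := hK.exists_isMaxOn ⟨z, hzK⟩ hφc
  have hφz : φ z = 0 := by simp [hφ, hz, bar, hzy, hc]
  have hφq : 0 ≤ φ q := hφz ▸ hqmax hzK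
  have hqB := hball hqK
  have hqball : q ∈ Metric.ball z (r / 2) := by
    rcases (Metric.mem_closedBall.1 hqK).lt_or_eq with h | h
    · exact h
    · exfalso
      by_cases hqr : ‖q - y‖ ≤ r
      · have := hεs q h hqr
        simp only [hφ] at hφq
        linarith
      · push Not at hqr
        have : bar α y q < c := by
          unfold bar
          rw [hc, Real.exp_lt_exp]
          have : r ^ 2 < ‖q - y‖ ^ 2 := by gcongr
          nlinarith
        have h2 := hle q hqB
        simp only [hφ] at hφq
        nlinarith
  have hloc : IsLocalMax φ q := by
    filter_upwards [Metric.isOpen_ball.mem_nhds hqball] with x hx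
    exact hqmax (Metric.ball_subset_closedBall hx)
  have hsec := second_deriv_nonpos φ q (hφC q hqB) hloc
  have hfst := hloc.fderiv_eq_zero
  -- derivatives of φ
  have hfd : ∀ x ∈ B, fderiv ℝ φ x = (fderiv ℝ u x - fderiv ℝ ubar x) + ε • fderiv ℝ (bar α y) x := by
    intro x hx
    have h1 := ((hCu x hx).differentiableAt (by norm_num)).hasFDerivAt
    have h2 := ((hCub x hx).differentiableAt (by norm_num)).hasFDerivAt
    have h3 := ((bar_contDiff α y).contDiffAt (x := x)).differentiableAt (by norm_num) |>.hasFDerivAt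
    exact ((h1.sub h2).add ((h3.sub_const c).const_mul ε)).fderiv
  have hfd2 : fderiv ℝ (fderiv ℝ φ) q = (fderiv ℝ (fderiv ℝ u) q - fderiv ℝ (fderiv ℝ ubar) q)
      + ε • fderiv ℝ (fderiv ℝ (bar α y)) q := by
    have hev : fderiv ℝ φ =ᶠ[nhds q] fun x =>
        (fderiv ℝ u x - fderiv ℝ ubar x) + ε • fderiv ℝ (bar α y) x := by
      filter_upwards [hB.mem_nhds hqB] with x hx using hfd x hx
    rw [hev.fderiv_eq]
    have hd : ∀ f : EuclideanSpace ℝ (Fin n) → ℝ, ContDiffAt ℝ 2 f q →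
        HasFDerivAt (fderiv ℝ f) (fderiv ℝ (fderiv ℝ f) q) q := fun f hf =>
      ((hf.fderiv_right (m := 1) (by norm_num)).differentiableAt (by norm_num)).hasFDerivAt
    exact (((hd u (hCu q hqB)).sub (hd ubar (hCub q hqB))).add
      ((hd _ (bar_contDiff α y).contDiffAt).const_smul ε)).fderiv
  -- the equation at q
  have heq1 := hequ q hqB
  have heq2 := hequbar q hqB
  rw [MCdiv_eq u q (hCu q hqB)] at heq1
  rw [MCdiv_eq ubar q (hCub q hqB)] at heq2
  have hQ1 := QQ_nonpos (gradient u q) _ hsec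
  rw [hfd2, QQ_add, QQ_sub, QQ_smul] at hQ1
  have hQ2 := QQ_bar α hα.le y q (gradient u q) S (hS q hqK)
  have he : 0 < bar α y q := Real.exp_pos _
  set e := bar α y q with hedef
  have hdist : dist q z < r / 2 := hqball
  rw [dist_eq_norm] at hdist
  have hd1 : r / 2 ≤ ‖q - y‖ := by
    have : ‖z - y‖ ≤ ‖q - z‖ + ‖q - y‖ := by
      rw [norm_sub_rev q z]; exact norm_sub_le_norm_sub_add_norm_sub z q y
    linarith
  have hd2 : ‖q - y‖ ≤ 2 * r := by
    have : ‖q - y‖ ≤ ‖q - z‖ + ‖z - y‖ := norm_sub_le_norm_sub_add_norm_sub q z y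
    linarith
  -- gradient term
  have hgrad : ‖gradient u q - gradient ubar q‖ ≤ ε * (2 * α * e * (2 * r)) := by
    rw [gradient_norm]
    have h1 : fderiv ℝ u q - fderiv ℝ ubar q = -(ε • fderiv ℝ (bar α y) q) := by
      rw [hfd q hqB] at hfst
      exact eq_neg_of_add_eq_zero_left hfst
    rw [h1, norm_neg, norm_smul, bar_fderiv]
    simp only [norm_smul, innerSL_apply_norm, Real.norm_eq_abs, abs_mul, abs_neg, abs_of_pos hε,
      abs_of_pos hα, ← hedef, abs_of_pos he, abs_two]
    gcongr
  have hQ3 : QQ (gradient u q) (fderiv ℝ (fderiv ℝ ubar) q)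
      - QQ (gradient ubar q) (fderiv ℝ (fderiv ℝ ubar) q) ≤ LQ * (ε * (2 * α * e * (2 * r))) := by
    refine (hLQ (gradient u q) (gradient ubar q) _ ((hM1 q hqK).trans (le_max_left _ _))
      ((hM2 q hqK).trans (le_max_right _ _)) (hM3 q hqK)).trans ?_
    gcongr
  -- zeroth-order term
  have hw : ubar q - u q ≤ ε * e := by
    simp only [hφ] at hφq
    have : 0 < ε * c := by positivity
    linarith
  have hH1 : H q (ubar q) - H q (u q) ≤ LH * (ε * e) := by
    have h1 : u q ∈ Metric.closedBall 0 (max N1 N2) := by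
      have := hN1 q hqK
      simp only [mem_closedBall_zero_iff]; exact this.trans (le_max_left _ _)
    have h2 : ubar q ∈ Metric.closedBall 0 (max N1 N2) := by
      have := hN2 q hqK
      simp only [mem_closedBall_zero_iff]; exact this.trans (le_max_right _ _)
    have h4 := hLH.dist_le_mul (q, ubar q) ⟨hqK, h2⟩ (q, u q) ⟨hqK, h1⟩
    rw [Prod.dist_eq] at h4
    simp only [dist_self, dist_eq_norm, sub_self, norm_zero, norm_nonneg, sup_of_le_right] at h4
    refine (le_abs_self _).trans (h4.trans ?_)
    have : ‖ubar q - u q‖ ≤ ε * e := by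
      rw [Real.norm_eq_abs, abs_of_nonneg (by linarith [hle q hqB])]; exact hw
    gcongr
  have hnH : n * (H q (ubar q) - H q (u q)) ≤ n * (LH * (ε * e)) := by gcongr
  have hQ2' : e * (α ^ 2 * (r ^ 2 * S⁻¹ ^ 3) - 2 * α * n) ≤
      QQ (gradient u q) (fderiv ℝ (fderiv ℝ (bar α y)) q) := by
    refine le_trans (mul_le_mul_of_nonneg_left ?_ he.le) hQ2
    have h1 : (r / 2) ^ 2 ≤ ‖q - y‖ ^ 2 := by gcongr
    have h2 : 4 * α ^ 2 * (r / 2) ^ 2 * S⁻¹ ^ 3 ≤ 4 * α ^ 2 * ‖q - y‖ ^ 2 * S⁻¹ ^ 3 := by gcongr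
    linarith
  have hfin : ε * (e * (α ^ 2 * (r ^ 2 * S⁻¹ ^ 3) - 2 * α * n)) ≤
      ε * (e * (LQ * (2 * α * (2 * r)) + n * LH)) := by
    have := mul_le_mul_of_nonneg_left hQ2' hε.le
    linarith
  have hfin2 := le_of_mul_le_mul_left (le_of_mul_le_mul_left hfin hε) he
  linarith

lemma ball_strict {E : Type*} [NormedAddCommGroup E] [InnerProductSpace ℝ E] (a b : E) (r : ℝ)
    (ha : ‖a‖ ≤ r) (hb : ‖b‖ = r) (hab : 2 * r ≤ ‖a + b‖) : a = b := by
  have h := parallelogram_law_with_norm ℝ a b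
  have hr : 0 ≤ r := hb ▸ norm_nonneg b
  have h1 : ‖a - b‖ * ‖a - b‖ ≤ 0 := by
    rw [hb] at h
    nlinarith [norm_nonneg a]
  have h2 : ‖a - b‖ = 0 := by nlinarith [norm_nonneg (a - b)]
  exact sub_eq_zero.1 (norm_eq_zero.1 h2)

/-- Interior tangency rigidity for prescribed mean curvature graphs: two solutions of
`div(∇v/√(1+|∇v|²)) = nH(x,v)` on a connected open set `B`, with `H` of class `C¹`,
ordered `u ≤ ū` and touching at an interior point, must coincide. -/
theorem interior_tangency_rigidity (n : ℕ) (B : Set (EuclideanSpace ℝ (Fin n)))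
    (hB : IsOpen B) (hBconn : IsConnected B)
    (H : EuclideanSpace ℝ (Fin n) → ℝ → ℝ)
    (hH : ContDiffOn ℝ 1 (Function.uncurry H) (B ×ˢ (Set.univ : Set ℝ)))
    (u ubar : EuclideanSpace ℝ (Fin n) → ℝ)
    (hu : ContDiffOn ℝ 2 u B) (hubar : ContDiffOn ℝ 2 ubar B)
    (hequ : ∀ x ∈ B, MCdiv u x = n * H x (u x))
    (hequbar : ∀ x ∈ B, MCdiv ubar x = n * H x (ubar x))
    (hle : ∀ x ∈ B, u x ≤ ubar x)
    (x₀ : EuclideanSpace ℝ (Fin n)) (hx₀ : x₀ ∈ B) (htouch : u x₀ = ubar x₀) :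
    Set.EqOn u ubar B := by
  set T : Set (EuclideanSpace ℝ (Fin n)) := {x | x ∈ B ∧ u x = ubar x} with hT
  have hopen : IsOpen T := by
    rw [Metric.isOpen_iff]
    rintro x₁ ⟨hx₁, hux₁⟩
    obtain ⟨δ', hδ', hsub'⟩ := Metric.isOpen_iff.1 hB x₁ hx₁
    set δ := δ' / 4 with hδdef
    have hδ : 0 < δ := by positivity
    have hsub : Metric.closedBall x₁ (3 * δ) ⊆ B :=
      (Metric.closedBall_subset_ball (by rw [hδdef]; linarith)).trans hsub'
    refine ⟨δ, hδ, fun y hy => ?_⟩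
    by_contra hyT
    have hyB : y ∈ B := hsub (Metric.ball_subset_closedBall
      (Metric.ball_subset_ball (by linarith) hy))
    have hsub2 : Metric.closedBall x₁ (2 * δ) ⊆ B :=
      (Metric.closedBall_subset_closedBall (by linarith)).trans hsub
    -- nearest point
    have hcomp : IsCompact {x | x ∈ Metric.closedBall x₁ (2 * δ) ∧ ubar x - u x = 0} := by
      have hcl := ((hubar.continuousOn.mono hsub2).sub
        (hu.continuousOn.mono hsub2)).preimage_isClosed_of_isClosed
          Metric.isClosed_closedBall (isClosed_singleton (x := (0:ℝ)))
      exact (isCompact_closedBall x₁ (2 * δ)).of_isClosed_subset hcl (fun x hx => hx.1)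
    have hx₁mem : x₁ ∈ {x | x ∈ Metric.closedBall x₁ (2 * δ) ∧ ubar x - u x = 0} :=
      ⟨Metric.mem_closedBall_self (by positivity), by linarith⟩
    obtain ⟨z, ⟨hzball, hz0⟩, hzmin⟩ := hcomp.exists_isMinOn ⟨x₁, hx₁mem⟩
      (f := fun x => dist x y) (by fun_prop)
    have hzB := hsub2 hzball
    have hyx : dist x₁ y < δ := by rw [dist_comm]; exact hy
    have hzy : dist z y < δ := lt_of_le_of_lt (hzmin hx₁mem) hyx
    have hzpos : 0 < dist z y := by
      rw [dist_pos]
      rintro rfl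
      exact hyT ⟨hyB, by linarith⟩
    have hfree : ∀ x ∈ B, dist x y < dist z y → u x < ubar x := by
      intro x hx hxy
      refine lt_of_le_of_ne (hle x hx) fun hxe => ?_
      have hxm : x ∈ {x | x ∈ Metric.closedBall x₁ (2 * δ) ∧ ubar x - u x = 0} := by
        refine ⟨?_, by linarith⟩
        rw [Metric.mem_closedBall]
        have := dist_triangle x y x₁
        rw [dist_comm y x₁] at this
        linarith
      have := hzmin hxm
      simp only [Set.mem_ofPred_eq] at this
      linarith
    set r := dist z y / 2 with hr
    set m := (1 / 2 : ℝ) • (y + z) with hm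
    have hmy : m - y = (1 / 2 : ℝ) • (z - y) := by
      rw [hm]; module
    have hzm : z - m = (1 / 2 : ℝ) • (z - y) := by
      rw [hm]; module
    have hnorm : ‖z - m‖ = r := by
      rw [hzm, norm_smul, hr, dist_eq_norm]; norm_num; ring
    refine barrier_core hB hH hu hubar hequ hequbar hle z m r (by positivity) hnorm ?_
      (by linarith) ?_
    · refine subset_trans ?_ hsub
      apply Metric.closedBall_subset_closedBall'
      have := Metric.mem_closedBall.1 hzball
      linarith
    · intro x hx hxr hxz
      apply hfree x hx
      by_contra hcon
      push Not at hcon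
      have := ball_strict (x - m) (z - m) r hxr hnorm (by
        have h1 : x - m + (z - m) = x - y := by rw [hzm, ← hmy]; abel
        rw [h1, ← dist_eq_norm]; linarith)
      exact hxz (sub_left_injective this)
  have hopen2 : IsOpen {x | x ∈ B ∧ u x ≠ ubar x} := by
    have := (hu.continuousOn.sub hubar.continuousOn).isOpen_inter_preimage hB
      (isOpen_compl_singleton (x := (0:ℝ)))
    have he : {x | x ∈ B ∧ u x ≠ ubar x} = B ∩ (u - ubar) ⁻¹' {0}ᶜ := by
      refine Set.ext fun x => and_congr Iff.rfl ?_
      exact sub_ne_zero.symm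
    rw [he]
    exact this
  intro x hx
  by_contra hne
  obtain ⟨w, hw, hw1, hw2⟩ := hBconn.isPreconnected T _ hopen hopen2
    (fun x hx => by
      by_cases h : u x = ubar x
      · exact Or.inl ⟨hx, h⟩
      · exact Or.inr ⟨hx, h⟩) ⟨x₀, hx₀, hx₀, htouch⟩ ⟨x, hx, hx, hne⟩
  exact hw2.2 hw1.2
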